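/- For every A ⊆ ℕ there exist disjoint sets A′ ⊆ ℕ and E ∈ N such that: (1) A = A′ ∪ E; (2) ν⁺(A′) = ν⁺(A); and (3) ν_N(A′) ≤ ν⁺(A′) for all N ∈ ℕ. Moreover, if A ∈ F, then A′ ∈ F (and hence ν(A′) = ν(A)). -/

import Mathlib

/-- The partial average `ν_N(A) = (1/N)·∑_{n=1}^N 1_A(n)`. -/
noncomputable def nuN (A : Set ℕ) (N : ℕ) : ℝ :=
  (∑ n ∈ Finset.Icc 1 N, A.indicator (fun _ => (1 : ℝ)) n) / N

/-- The upper Cesàro limit `ν⁺(A)`. -/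
noncomputable def nuPlus (A : Set ℕ) : ℝ :=
  Filter.limsup (fun N => nuN A N) Filter.atTop

/-- The lower Cesàro limit `ν⁻(A)`. -/
noncomputable def nuMinus (A : Set ℕ) : ℝ :=
  Filter.liminf (fun N => nuN A N) Filter.atTop

/-- `A ∈ F`: the Cesàro limit of `A` exists. -/
def memF (A : Set ℕ) : Prop :=
  ∃ l : ℝ, Filter.Tendsto (fun N => nuN A N) Filter.atTop (nhds l)

/-- The Cesàro limit `ν(A)`; it coincides with `ν⁺(A)` whenever `A ∈ F`. -/
noncomputable def nu (A : Set ℕ) : ℝ := nuPlus A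

/-- `A ∈ N`: `A` is a null set. -/
def nullSet (A : Set ℕ) : Prop := memF A ∧ nu A = 0

open Filter Topology

/-- The number of positive elements of `A` up to `N`, as a real number. -/
noncomputable def countUpTo (A : Set ℕ) (N : ℕ) : ℝ :=
  ∑ n ∈ Finset.Icc 1 N, A.indicator (fun _ => (1 : ℝ)) n

theorem nuN_eq_countUpTo_div (A : Set ℕ) (N : ℕ) : nuN A N = countUpTo A N / N := rfl

theorem countUpTo_zero (A : Set ℕ) : countUpTo A 0 = 0 := by
  simp [countUpTo]

theorem countUpTo_succ (A : Set ℕ) (N : ℕ) :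
    countUpTo A (N + 1) = countUpTo A N + A.indicator (fun _ => (1 : ℝ)) (N + 1) := by
  unfold countUpTo
  rw [Finset.sum_Icc_succ_top (by omega)]

theorem countUpTo_nonneg (A : Set ℕ) (N : ℕ) : 0 ≤ countUpTo A N :=
  Finset.sum_nonneg fun n _ => Set.indicator_nonneg (fun _ _ => zero_le_one) n

theorem countUpTo_le (A : Set ℕ) (N : ℕ) : countUpTo A N ≤ N := by
  induction N with
  | zero => simp [countUpTo_zero]
  | succ N ih =>
    rw [countUpTo_succ]
    have : A.indicator (fun _ => (1 : ℝ)) (N + 1) ≤ 1 :=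
      Set.indicator_le_self' (fun _ _ => zero_le_one) _
    push_cast
    linarith

theorem nuN_nonneg (A : Set ℕ) (N : ℕ) : 0 ≤ nuN A N :=
  div_nonneg (countUpTo_nonneg A N) N.cast_nonneg

theorem nuN_le_one (A : Set ℕ) (N : ℕ) : nuN A N ≤ 1 :=
  div_le_one_of_le₀ (countUpTo_le A N) N.cast_nonneg

theorem isBoundedUnder_le_nuN (A : Set ℕ) : IsBoundedUnder (· ≤ ·) atTop (nuN A) :=
  isBoundedUnder_of ⟨1, nuN_le_one A⟩

theorem isBoundedUnder_ge_nuN (A : Set ℕ) : IsBoundedUnder (· ≥ ·) atTop (nuN A) :=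
  isBoundedUnder_of ⟨0, nuN_nonneg A⟩

theorem nuPlus_nonneg (A : Set ℕ) : 0 ≤ nuPlus A :=
  le_limsup_of_frequently_le (Frequently.of_forall (nuN_nonneg A)) (isBoundedUnder_le_nuN A)

theorem nuN_union {A B : Set ℕ} (h : Disjoint A B) (N : ℕ) :
    nuN (A ∪ B) N = nuN A N + nuN B N := by
  unfold nuN
  rw [← add_div, ← Finset.sum_add_distrib, Set.indicator_union_of_disjoint h]

theorem tendsto_zero_of_nullSet {E : Set ℕ} (hE : nullSet E) : Tendsto (nuN E) atTop (𝓝 0) := by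
  obtain ⟨⟨l, hl⟩, h⟩ := hE
  have : l = 0 := hl.limsup_eq.symm.trans h
  exact this ▸ hl

theorem nullSet_of_tendsto_zero {E : Set ℕ} (hE : Tendsto (nuN E) atTop (𝓝 0)) : nullSet E :=
  ⟨⟨0, hE⟩, hE.limsup_eq⟩

theorem nuPlus_union_nullSet {A E : Set ℕ} (h : Disjoint A E) (hE : nullSet E) :
    nuPlus (A ∪ E) = nuPlus A := by
  apply le_antisymm
  · refine le_of_forall_pos_le_add fun ε hε => ?_
    have h₁ := eventually_lt_of_limsup_lt (b := nuPlus A + ε / 2)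
      (show limsup (nuN A) atTop < _ by change nuPlus A < _; linarith) (isBoundedUnder_le_nuN A)
    have h₂ := (tendsto_zero_of_nullSet hE).eventually_lt_const (half_pos hε)
    refine limsup_le_of_le (isBoundedUnder_ge_nuN _).isCoboundedUnder_flip ?_
    filter_upwards [h₁, h₂] with N h₁ h₂
    rw [nuN_union h]
    linarith
  · refine limsup_le_limsup (Eventually.of_forall fun N => ?_)
      (isBoundedUnder_ge_nuN _).isCoboundedUnder_flip (isBoundedUnder_le_nuN _)
    change nuN A N ≤ nuN (A ∪ E) N
    rw [nuN_union h]
    linarith [nuN_nonneg E N]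

theorem exists_countUpTo_le (A : Set ℕ) {ε : ℝ} (hε : 0 < ε) :
    ∃ C : ℝ, 0 ≤ C ∧ ∀ N : ℕ, countUpTo A N ≤ (nuPlus A + ε) * N + C := by
  have h := eventually_lt_of_limsup_lt (b := nuPlus A + ε)
    (show limsup (nuN A) atTop < _ by change nuPlus A < _; linarith) (isBoundedUnder_le_nuN A)
  obtain ⟨M, hM⟩ := eventually_atTop.1 h
  refine ⟨M, M.cast_nonneg, fun N => ?_⟩
  have h₀ := nuPlus_nonneg A
  rcases le_total N M with hN | hN
  · have h₁ : (N : ℝ) ≤ M := by exact_mod_cast hN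
    have h₂ : 0 ≤ (nuPlus A + ε) * N := by positivity
    linarith [countUpTo_le A N]
  · rcases N.eq_zero_or_pos with rfl | hpos
    · simp [countUpTo_zero]
    · have hpos' : (0 : ℝ) < N := by exact_mod_cast hpos
      have h₁ := hM N hN
      rw [nuN_eq_countUpTo_div, div_lt_iff₀ hpos'] at h₁
      linarith [M.cast_nonneg (α := ℝ)]

open Classical in
/-- The counting function of the greedy subset of `A` that keeps an element `n` exactly when the
resulting count does not exceed `α * n`. -/
noncomputable def greedyCount (A : Set ℕ) (α : ℝ) : ℕ → ℕ
  | 0 => 0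
  | n + 1 =>
    if n + 1 ∈ A ∧ (greedyCount A α n : ℝ) + 1 ≤ α * ((n + 1 : ℕ) : ℝ) then
      greedyCount A α n + 1
    else greedyCount A α n

/-- The greedy subset of `A` whose counting function stays below `α * n`. -/
def greedySubset (A : Set ℕ) (α : ℝ) : Set ℕ :=
  {n | n ∈ A ∧ (greedyCount A α (n - 1) : ℝ) + 1 ≤ α * n}

theorem greedySubset_subset (A : Set ℕ) (α : ℝ) : greedySubset A α ⊆ A := fun _ h => h.1

theorem countUpTo_greedySubset (A : Set ℕ) (α : ℝ) (N : ℕ) :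
    countUpTo (greedySubset A α) N = greedyCount A α N := by
  classical
  induction N with
  | zero => simp [countUpTo_zero, greedyCount]
  | succ N ih =>
    rw [countUpTo_succ, ih, Set.indicator_apply, greedyCount]
    simp only [greedySubset, Set.mem_ofPred_eq, Nat.add_sub_cancel]
    split_ifs <;> simp

theorem succ_mem_greedySubset {A : Set ℕ} {α : ℝ} {N : ℕ} :
    N + 1 ∈ greedySubset A α ↔
      N + 1 ∈ A ∧ countUpTo (greedySubset A α) N + 1 ≤ α * ((N : ℝ) + 1) := by
  rw [countUpTo_greedySubset]
  simp [greedySubset]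

theorem countUpTo_greedySubset_le (A : Set ℕ) {α : ℝ} (hα : 0 ≤ α) (N : ℕ) :
    countUpTo (greedySubset A α) N ≤ α * N := by
  induction N with
  | zero => simp [countUpTo_zero]
  | succ N ih =>
    rw [countUpTo_succ]
    push_cast
    by_cases h : N + 1 ∈ greedySubset A α
    · rw [Set.indicator_of_mem h]
      exact (succ_mem_greedySubset.1 h).2
    · rw [Set.indicator_of_notMem h]
      linarith

theorem countUpTo_diff_greedySubset_le {A : Set ℕ} {α ε C : ℝ} (hε : 0 ≤ ε) (hC : 0 ≤ C)
    (hA : ∀ N : ℕ, countUpTo A N ≤ (α + ε) * N + C) (N : ℕ) :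
    countUpTo A N - countUpTo (greedySubset A α) N ≤ ε * N + C + 1 := by
  induction N with
  | zero => simp only [countUpTo_zero, Nat.cast_zero]; linarith
  | succ N ih =>
    have h := hA (N + 1)
    rw [countUpTo_succ] at h ⊢
    rw [countUpTo_succ]
    push_cast at h ⊢
    by_cases h₁ : N + 1 ∈ A
    · by_cases h₂ : N + 1 ∈ greedySubset A α
      · rw [Set.indicator_of_mem h₁, Set.indicator_of_mem h₂]
        linarith
      · have h₃ := h₂
        rw [succ_mem_greedySubset, not_and, not_le] at h₃
        have h₄ := h₃ h₁
        rw [Set.indicator_of_notMem h₂]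
        linarith
    · rw [Set.indicator_of_notMem h₁,
        Set.indicator_of_notMem fun h₂ => h₁ (greedySubset_subset A α h₂)]
      linarith

theorem nullSet_diff_greedySubset (A : Set ℕ) : nullSet (A \ greedySubset A (nuPlus A)) := by
  apply nullSet_of_tendsto_zero
  set B := greedySubset A (nuPlus A)
  refine tendsto_order.2 ⟨fun a ha => Eventually.of_forall fun N => ha.trans_le (nuN_nonneg _ N),
    fun ε hε => ?_⟩
  obtain ⟨C, hC, hA⟩ := exists_countUpTo_le A (half_pos hε)
  have hlim : Tendsto (fun N : ℕ => (C + 1) / (N : ℝ)) atTop (𝓝 0) :=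
    tendsto_const_div_atTop_nhds_zero_nat _
  filter_upwards [hlim.eventually_lt_const (half_pos hε), eventually_gt_atTop 0] with N hN hpos
  have hpos' : (0 : ℝ) < N := by exact_mod_cast hpos
  have h := countUpTo_diff_greedySubset_le (half_pos hε).le hC hA N
  have hsplit := nuN_union (Set.disjoint_sdiff_right (s := B) (t := A)) N
  rw [Set.union_sdiff_cancel (greedySubset_subset A _)] at hsplit
  have hdiv : nuN A N - nuN B N ≤ ε / 2 + (C + 1) / N := by
    rw [nuN_eq_countUpTo_div, nuN_eq_countUpTo_div, ← sub_div, div_le_iff₀ hpos', add_mul,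
      div_mul_cancel₀ _ hpos'.ne']
    linarith
  linarith

theorem stmt11 (A : Set ℕ) :
    ∃ A' E : Set ℕ, Disjoint A' E ∧ nullSet E ∧ A = A' ∪ E ∧
      nuPlus A' = nuPlus A ∧ (∀ N : ℕ, nuN A' N ≤ nuPlus A') ∧
      (memF A → memF A' ∧ nu A' = nu A) := by
  set B := greedySubset A (nuPlus A)
  have hdisj : Disjoint B (A \ B) := Set.disjoint_sdiff_right
  have hnull : nullSet (A \ B) := nullSet_diff_greedySubset A
  have hunion : B ∪ A \ B = A := Set.union_sdiff_cancel (greedySubset_subset A _)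
  have hplus : nuPlus B = nuPlus A := by
    rw [← nuPlus_union_nullSet hdisj hnull, hunion]
  refine ⟨B, A \ B, hdisj, hnull, hunion.symm, hplus, fun N => ?_, ?_⟩
  · rw [hplus, nuN_eq_countUpTo_div]
    exact div_le_of_le_mul₀ N.cast_nonneg (nuPlus_nonneg A)
      (countUpTo_greedySubset_le A (nuPlus_nonneg A) N)
  · rintro ⟨l, hl⟩
    refine ⟨⟨l, ?_⟩, hplus⟩
    have h := hl.sub (tendsto_zero_of_nullSet hnull)
    rw [sub_zero] at h
    refine h.congr fun N => ?_
    have hsplit := nuN_union hdisj N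
    rw [hunion] at hsplit
    linarith
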